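/- arXiv:1612.05205 — 2 statements merged into one kernel-verified Lean document; each statement's English description precedes it below -/
import Mathlib

section
/- Let the HLC receive-update be applied to a current HLC timestamp (l', c') with physical clock value pt and incoming message timestamp (ml, mc). Then the resulting timestamp (l, c) satisfies: l = max(l', ml, pt); (l, c) is strictly greater than (l', c') in the lexicographic order on ℕ × ℕ; (l, c) is strictly greater than (ml, mc) in the lexicographic order; and l ≥ pt. -/
/-- Lexicographic strict order on HLC timestamps, i.e. pairs `(l, c)` of naturals:
`(l₁, c₁) < (l₂, c₂)` iff `l₁ < l₂`, or `l₁ = l₂` and `c₁ < c₂`. -/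
def hlcLt (a b : ℕ × ℕ) : Prop :=
  a.1 < b.1 ∨ (a.1 = b.1 ∧ a.2 < b.2)

/-- The HLC receive-update: from current timestamp `(l', c')`, physical clock value `pt`,
and incoming message timestamp `(ml, mc)`, produce `(l, c)` with `l = max(l', ml, pt)`
and `c` defined by cases as in the HLC algorithm. -/
def hlcRecv (l' c' pt ml mc : ℕ) : ℕ × ℕ :=
  let l := max l' (max ml pt)
  if l = l' ∧ l = ml then (l, max c' mc + 1)
  else if l = l' then (l, c' + 1)
  else if l = ml then (l, mc + 1)
  else (l, 0)

/-- The result `(l, c)` of the HLC receive-update satisfies: `l = max(l', ml, pt)`;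
`(l, c)` is lexicographically strictly greater than the current timestamp `(l', c')`;
`(l, c)` is lexicographically strictly greater than the message timestamp `(ml, mc)`;
and `l ≥ pt`. -/
theorem hlcRecv_spec (l' c' pt ml mc : ℕ) :
    (hlcRecv l' c' pt ml mc).1 = max l' (max ml pt) ∧
    hlcLt (l', c') (hlcRecv l' c' pt ml mc) ∧
    hlcLt (ml, mc) (hlcRecv l' c' pt ml mc) ∧
    pt ≤ (hlcRecv l' c' pt ml mc).1 := by
  unfold hlcRecv hlcLt
  dsimp only
  split_ifs <;> dsimp only <;> omega
end

section
/- Consider an execution of a replicated multi-version key-value store modeled as a finite sequence of PUT and GET operations by clients, where timestamps are drawn from a linearly ordered set. Each client c maintains a dependency time DT_c, initially the minimum timestamp: after a GET returning a version with timestamp ut, DT_c is updated to max(DT_c, ut); after a PUT creating a version with timestamp ut, DT_c is updated to max(DT_c, ut). Suppose that every PUT assigns the newly created version a timestamp strictly greater than the issuing client's current dependency time DT_c. Then condition C1 holds for this execution: for all versions X and Y, if X causally depends on Y (the PUT creating Y happens-before the PUT creating X), then the timestamp of Y is strictly less than the timestamp of X. -/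
/-- Consider an execution of a replicated multi-version key-value store modeled as a
finite sequence of `n` operations (indexed by `Fin n` in temporal order), with
timestamps from a linearly ordered set `T` with a least element `⊥`.  Operation `i`
is issued by client `client i`; it is a PUT iff `isPut i = true`, in which case it
creates a version identified with `i` carrying timestamp `ts i`; otherwise it is a
GET returning the version created by the PUT `ret i`.  Each client `c` maintains a
dependency time: `dt m c` is `DT_c` after the first `m` operations, with
`dt 0 c = ⊥`, and after operation `i` the issuing client takes the max of its
dependency time with the timestamp of the version created (for a PUT) or returned
(for a GET).  Suppose every PUT gets a timestamp strictly greater than the issuing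
client's current dependency time.  Then condition C1 holds: if the PUT `i` happens
before the PUT `j` (transitive closure of same-client program order and
PUT-to-returning-GET edges), i.e. version `j` causally depends on version `i`,
then `ts i < ts j`. -/
theorem hlc_timestamps_satisfy_C1 {C T : Type} [DecidableEq C] [LinearOrder T] [OrderBot T] {n : ℕ}
    (client : Fin n → C) (isPut : Fin n → Bool) (ret : Fin n → Fin n)
    (ts : Fin n → T) (dt : ℕ → C → T)
    (hret : ∀ i, isPut i = false → isPut (ret i) = true)
    (hdt0 : ∀ c, dt 0 c = ⊥)
    (hdtstep : ∀ (i : Fin n) (c : C),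
      dt (i.val + 1) c =
        if client i = c
          then max (dt i.val c) (ts (if isPut i then i else ret i))
          else dt i.val c)
    (hput : ∀ i : Fin n, isPut i = true → dt i.val (client i) < ts i)
    (i j : Fin n) (hi : isPut i = true) (hj : isPut j = true)
    (hhb : Relation.TransGen (fun a b : Fin n =>
      (client a = client b ∧ a < b) ∨
      (isPut a = true ∧ isPut b = false ∧ ret b = a)) i j) :
    ts i < ts j := by
  have step : ∀ (k : Fin n) (c : C), dt k.val c ≤ dt (k.val + 1) c := by
    intro k c
    rw [hdtstep k c]
    split_ifs
    · exact le_max_left _ _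
    · exact le_max_left _ _
    · exact le_rfl
  have mono : ∀ (c : C) (a b : ℕ), a ≤ b → b ≤ n → dt a c ≤ dt b c := by
    intro c a b hab
    induction b, hab using Nat.le_induction with
    | base => intro _; exact le_rfl
    | succ m hm ih =>
      intro hmn
      exact (ih (by omega)).trans (step ⟨m, by omega⟩ c)
  have own : ∀ k : Fin n, ts (if isPut k then k else ret k) ≤ dt (k.val + 1) (client k) := by
    intro k
    rw [hdtstep k (client k), if_pos rfl]
    exact le_max_right _ _
  have putD : ∀ k : Fin n, isPut k = true → dt (k.val + 1) (client k) = ts k := by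
    intro k hk
    rw [hdtstep k (client k), if_pos rfl, if_pos hk]
    exact max_eq_right (hput k hk).le
  have edge : ∀ a b : Fin n, ((client a = client b ∧ a < b) ∨
      (isPut a = true ∧ isPut b = false ∧ ret b = a)) →
      dt (a.val + 1) (client a) ≤ dt (b.val + 1) (client b) := by
    rintro a b (⟨hc, hab⟩ | ⟨ha, hb, hr⟩)
    · rw [hc]
      have : a.val < b.val := hab
      exact mono _ _ _ (by omega) (by omega)
    · rw [putD a ha]
      have := own b
      simpa [hb, hr] using this
  obtain ⟨a, hia, haj⟩ := Relation.TransGen.tail'_iff.mp hhb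
  have h1 : dt (i.val + 1) (client i) ≤ dt (a.val + 1) (client a) := by
    clear haj
    induction hia with
    | refl => exact le_rfl
    | tail _ h ih => exact ih.trans (edge _ _ h)
  rw [putD i hi] at h1
  rcases haj with ⟨hc, hab⟩ | ⟨_, hb, _⟩
  · have : a.val < j.val := hab
    rw [hc] at h1
    exact (h1.trans (mono _ _ _ (by omega) (by omega))).trans_lt (hput j hj)
  · simp [hj] at hb
end
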